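/- arXiv:2212.08347 — 2 statements merged into one kernel-verified Lean document; each statement's English description precedes it below -/
import Mathlib

section
/- Let M be a reduced, cancellative, commutative torsion-free monoid (i.e., its difference group is torsion-free). Then M satisfies the ascending chain condition on principal ideals (ACCP) if and only if every submonoid of M is atomic. -/
/-- `x` is invertible in the monoid `M`. -/
def IsMUnit {M : Type*} [AddCommMonoid M] (x : M) : Prop := ∃ y, x + y = 0

/-- Principal ideal `b + M`. -/
def PIdeal {M : Type*} [AddCommMonoid M] (b : M) : Set M := {x | ∃ c, x = b + c}

/-- `M` satisfies the ascending chain condition on principal ideals. -/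
def SatisfiesACCP (M : Type*) [AddCommMonoid M] : Prop :=
  ∀ f : ℕ → M, (∀ n, PIdeal (f n) ⊆ PIdeal (f (n + 1))) →
    ∃ N, ∀ n, N ≤ n → PIdeal (f n) = PIdeal (f N)

/-- `x` is invertible in the submonoid `N`. -/
def IsUnitIn {M : Type*} [AddCommMonoid M] (N : AddSubmonoid M) (x : M) : Prop :=
  ∃ y ∈ N, x + y = 0

/-- `a` is an atom of the submonoid `N`. -/
def IsAtomIn {M : Type*} [AddCommMonoid M] (N : AddSubmonoid M) (a : M) : Prop :=
  a ∈ N ∧ ¬ IsUnitIn N a ∧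
    ∀ b ∈ N, ∀ c ∈ N, a = b + c → IsUnitIn N b ∨ IsUnitIn N c

/-- The submonoid `N` is atomic: every non-invertible element of `N` is a finite
sum of atoms of `N`. -/
def AtomicIn {M : Type*} [AddCommMonoid M] (N : AddSubmonoid M) : Prop :=
  ∀ x ∈ N, IsUnitIn N x ∨
    ∃ l : Multiset M, (∀ a ∈ l, IsAtomIn N a) ∧ l.sum = x

section Helpers

variable {M : Type*} [AddCancelCommMonoid M]

/-- Divisibility in an additive monoid. -/
def MLe (x y : M) : Prop := ∃ r, y = x + r

theorem MLe.trans' {x y z : M} (h : MLe x y) (h' : MLe y z) : MLe x z := by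
  obtain ⟨r, rfl⟩ := h
  obtain ⟨s, rfl⟩ := h'
  exact ⟨r + s, by rw [add_assoc]⟩

theorem MLe.add_right' {x y : M} (h : MLe x y) (z : M) : MLe (x + z) (y + z) := by
  obtain ⟨r, rfl⟩ := h
  exact ⟨r, by rw [add_right_comm]⟩

theorem MLe.nsmul' {x y : M} (h : MLe x y) (n : ℕ) : MLe (n • x) (n • y) := by
  obtain ⟨r, rfl⟩ := h
  exact ⟨n • r, by rw [nsmul_add]⟩

theorem atom_mem_of_closure (hred : ∀ x : M, IsMUnit x → x = 0) (S : Set M) (a : M)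
    (ha : IsAtomIn (AddSubmonoid.closure S) a) : a ∈ S := by
  obtain ⟨hm, hu, hs⟩ := ha
  have key : ∀ x ∈ AddSubmonoid.closure S, x = 0 ∨ ∃ s ∈ S, ∃ y ∈ AddSubmonoid.closure S,
      x = s + y ∧ s ≠ 0 := by
    intro x hx
    induction hx using AddSubmonoid.closure_induction with
    | mem x hx =>
      by_cases h : x = 0
      · exact Or.inl h
      · exact Or.inr ⟨x, hx, 0, zero_mem _, by simp, h⟩
    | zero => exact Or.inl rfl
    | add x y hx hy ihx ihy =>
      rcases ihx with rfl | ⟨s, hs, z, hz, rfl, h0⟩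
      · simpa using ihy
      · exact Or.inr ⟨s, hs, z + y, add_mem hz hy, by rw [add_assoc], h0⟩
  rcases key a hm with rfl | ⟨s, hsS, y, hy, rfl, h0⟩
  · exact absurd ⟨0, zero_mem _, by simp⟩ hu
  · rcases hs s (AddSubmonoid.subset_closure hsS) y hy rfl with ⟨z, _, hz⟩ | ⟨z, _, hz⟩
    · exact absurd (hred s ⟨z, hz⟩) h0
    · have := hred y ⟨z, hz⟩
      simpa [this] using hsS

theorem chain_key (hred : ∀ x : M, IsMUnit x → x = 0)
    (hat : ∀ N : AddSubmonoid M, AtomicIn N) (g : M) (e : ℕ → M) (he : ∀ j, e j ≠ 0)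
    (hg : ∀ k, MLe (∑ i ∈ Finset.range k, e i) g) :
    g ∈ AddSubmonoid.closure (Set.range e) := by
  choose r hr using hg
  have hr1 : ∀ k, r k = e k + r (k + 1) := by
    intro k
    have h1 := hr k
    rw [hr (k + 1), Finset.sum_range_succ, add_assoc] at h1
    exact (add_left_cancel h1).symm
  have hr0 : ∀ k, r k ≠ 0 := by
    intro k h
    exact he k (hred _ ⟨r (k + 1), by rw [← hr1, h]⟩)
  have hg0 : g = r 0 := by simpa using hr 0
  set N := AddSubmonoid.closure (Set.range e ∪ Set.range r) with hN
  have hrN : ∀ k, r k ∈ N := fun k => AddSubmonoid.subset_closure (Or.inr ⟨k, rfl⟩)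
  have heN : ∀ k, e k ∈ N := fun k => AddSubmonoid.subset_closure (Or.inl ⟨k, rfl⟩)
  rcases hat N g (hg0 ▸ hrN 0) with ⟨y, _, hy⟩ | ⟨l, hl, rfl⟩
  · rw [hred g ⟨y, hy⟩]
    exact zero_mem _
  · refine AddSubmonoid.multiset_sum_mem _ _ fun a ha => ?_
    have haa := hl a ha
    rcases atom_mem_of_closure hred _ a haa with h | ⟨k, rfl⟩
    · exact AddSubmonoid.subset_closure h
    · exfalso
      rcases haa.2.2 _ (heN k) _ (hrN (k + 1)) (hr1 k) with ⟨z, _, hz⟩ | ⟨z, _, hz⟩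
      · exact he k (hred _ ⟨z, hz⟩)
      · exact hr0 (k + 1) (hred _ ⟨z, hz⟩)

theorem archim (hred : ∀ x : M, IsMUnit x → x = 0)
    (hat : ∀ N : AddSubmonoid M, AtomicIn N) (f d : M) (hd : d ≠ 0) :
    ∃ c : ℕ, ¬ MLe (c • d) f := by
  by_contra! h
  have h1 := chain_key hred hat f (fun _ => d) (fun _ => hd) (by intro k; simpa using h k)
  rw [Set.range_const, AddSubmonoid.mem_closure_singleton] at h1
  obtain ⟨n, rfl⟩ := h1
  obtain ⟨r, hr⟩ := h (n + 1)
  rw [succ_nsmul, add_assoc] at hr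
  exact hd (hred d ⟨r, by simpa using hr.symm⟩)

theorem inf_div_zero {G : Type*} [AddCommGroup G] [IsAddTorsionFree G] (H : Submodule ℤ G)
    (hH : H.FG) (x : G) (hx : ∀ b : ℕ, b ≠ 0 → ∃ h ∈ H, x = b • h) : x = 0 := by
  have : Module.Finite ℤ H := Module.Finite.iff_fg.2 hH
  have hxH : x ∈ H := by
    obtain ⟨h, hh, e⟩ := hx 1 one_ne_zero
    simpa [e] using hh
  let B := Module.Free.chooseBasis ℤ H
  have : (⟨x, hxH⟩ : H) = 0 := by
    apply B.repr.injective
    ext i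
    rw [map_zero, Finsupp.zero_apply]
    obtain ⟨h, hh, e⟩ := hx ((B.repr ⟨x, hxH⟩ i).natAbs + 1) (by omega)
    have e2 : (⟨x, hxH⟩ : H) = ((B.repr ⟨x, hxH⟩ i).natAbs + 1) • (⟨h, hh⟩ : H) :=
      Subtype.ext e
    have e3 : B.repr ⟨x, hxH⟩ i
        = (((B.repr ⟨x, hxH⟩ i).natAbs + 1 : ℕ) : ℤ) * B.repr ⟨h, hh⟩ i := by
      conv_lhs => rw [e2]
      rw [map_nsmul]
      simp
    refine Int.eq_zero_of_dvd_of_natAbs_lt_natAbs ⟨_, e3⟩ ?_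
    rw [Int.natAbs_natCast]
    omega
  simpa using congrArg Subtype.val this

theorem step {G : Type*} [AddCommGroup G] [IsAddTorsionFree G] (ι : M →+ G)
    (hι : Function.Injective ι)
    (hred : ∀ x : M, IsMUnit x → x = 0)
    (hat : ∀ N : AddSubmonoid M, AtomicIn N) (f : M) (d : ℕ → M) (hd : ∀ j, d j ≠ 0)
    (hf : ∀ k, MLe (∑ i ∈ Finset.range k, d i) f) (n : ℕ) :
    ∃ m, n < m ∧ ∀ c : ℕ, c ≠ 0 →
      c • ι (d n + d m) ∈ Submodule.span ℤ ({ι f} ∪ (fun i => ι (d i)) '' Set.Iio n) →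
      ¬ MLe (c • (d n + d m)) f := by
  by_contra! hcon
  obtain ⟨C, hC⟩ := archim hred hat f (d n) (hd n)
  set H := Submodule.span ℤ ({ι f} ∪ (fun i => ι (d i)) '' Set.Iio (n + 1)) with hH
  have hHfg : H.FG := Submodule.fg_span
    ((Set.finite_singleton _).union ((Set.finite_Iio _).image _))
  have hfH : ι f ∈ H := Submodule.subset_span (Or.inl rfl)
  have hnH : ι (d n) ∈ H := Submodule.subset_span (Or.inr ⟨n, by simp, rfl⟩)
  have hsub : Submodule.span ℤ ({ι f} ∪ (fun i => ι (d i)) '' Set.Iio n) ≤ H :=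
    Submodule.span_mono (Set.union_subset_union_right _
      (Set.image_mono (Set.Iio_subset_Iio (Nat.le_succ n))))
  have hmem : ∀ m, n < m → C.factorial • ι (d m) ∈ H := by
    intro m hm
    obtain ⟨c, hc0, hcH, hcf⟩ := hcon m hm
    have hcC : c < C := by
      by_contra! hle
      apply hC
      obtain ⟨k, rfl⟩ := Nat.exists_eq_add_of_le hle
      refine MLe.trans' ?_ hcf
      exact ⟨k • d n + (C + k) • d m, by rw [nsmul_add, add_nsmul, add_assoc]⟩
    obtain ⟨q, hq⟩ := Nat.dvd_factorial (Nat.pos_of_ne_zero hc0) hcC.le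
    have h1 : C.factorial • ι (d n + d m) ∈ H := by
      rw [hq, mul_comm, mul_nsmul']
      exact nsmul_mem (hsub hcH) q
    have h2 := sub_mem h1 (nsmul_mem hnH C.factorial)
    rwa [map_add, nsmul_add, add_sub_cancel_left] at h2
  have hz : C.factorial • ι (d 0) = 0 := by
    refine inf_div_zero H hHfg _ fun b hb => ?_
    have hcl := chain_key hred hat (b • f + d 0) (fun j => b • d (n + 1 + j))
      (fun j h => hd (n + 1 + j) ?_) (fun k => ?_)
    · have hall : ∀ x ∈ AddSubmonoid.closure (Set.range (fun j => b • d (n + 1 + j))),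
          ∃ h ∈ H, C.factorial • ι x = b • h := by
        intro x hx
        induction hx using AddSubmonoid.closure_induction with
        | mem x hx =>
          obtain ⟨j, rfl⟩ := hx
          refine ⟨_, hmem (n + 1 + j) (by omega), ?_⟩
          simp only [map_nsmul]
          rw [smul_comm]
        | zero => exact ⟨0, zero_mem _, by simp⟩
        | add x y _ _ ihx ihy =>
          obtain ⟨h, hh, e⟩ := ihx
          obtain ⟨h', hh', e'⟩ := ihy
          exact ⟨h + h', add_mem hh hh', by rw [map_add, nsmul_add, e, e', nsmul_add]⟩
      obtain ⟨h, hh, e⟩ := hall _ hcl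
      refine ⟨h - C.factorial • ι f, sub_mem hh (nsmul_mem hfH _), ?_⟩
      rw [nsmul_sub, ← e, map_add, map_nsmul, nsmul_add, smul_comm b, add_sub_cancel_left]
    · apply hι
      apply nsmul_right_injective hb
      simpa using congrArg ι h
    · rw [← Finset.smul_sum]
      have h1 : MLe (∑ j ∈ Finset.range k, d (n + 1 + j)) f := by
        refine MLe.trans' ⟨∑ j ∈ Finset.range (n + 1), d j, ?_⟩ (hf (n + 1 + k))
        rw [Finset.sum_range_add, add_comm]
      exact (h1.nsmul' b).trans' ⟨d 0, rfl⟩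
  apply hd 0
  apply hι
  apply nsmul_right_injective (Nat.factorial_ne_zero C)
  simpa using hz

theorem no_chain {G : Type*} [AddCommGroup G] [IsAddTorsionFree G] (ι : M →+ G)
    (hι : Function.Injective ι)
    (hred : ∀ x : M, IsMUnit x → x = 0)
    (hat : ∀ N : AddSubmonoid M, AtomicIn N) (f : M) (d : ℕ → M) (hd : ∀ j, d j ≠ 0)
    (hf : ∀ k, MLe (∑ i ∈ Finset.range k, d i) f) : False := by
  choose g hg1 hg2 using step ι hι hred hat f d hd hf
  let ν : ℕ → ℕ := fun k => Nat.rec 0 (fun _ p => g p + 1) k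
  have hν : ∀ k, ν (k + 1) = g (ν k) + 1 := fun k => rfl
  have hνm : StrictMono ν := strictMono_nat_of_lt_succ fun k => by
    rw [hν]
    have := hg1 (ν k)
    omega
  let e : ℕ → M := fun k => d (ν k) + d (g (ν k))
  have he : ∀ k, e k ≠ 0 := fun k h => hd (ν k) (hred _ ⟨_, h⟩)
  have hS : ∀ k, MLe (∑ i ∈ Finset.range k, e i) (∑ i ∈ Finset.range (ν k), d i) := by
    intro k
    induction k with
    | zero => exact ⟨0, by simp [ν]⟩
    | succ k ih =>
      rw [hν, Finset.sum_range_succ, Finset.sum_range_succ, ← add_assoc]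
      refine MLe.add_right' ?_ _
      refine (ih.add_right' _).trans' ?_
      rw [← Finset.sum_range_succ]
      obtain ⟨q, hq⟩ := Nat.exists_eq_add_of_le (hg1 (ν k))
      rw [hq]
      exact ⟨_, Finset.sum_range_add _ _ _⟩
  have hcl := chain_key hred hat f e he fun k => (hS k).trans' (hf _)
  obtain ⟨c, hc⟩ := AddSubmonoid.exists_finsupp_of_mem_closure_range e f hcl
  have hf0 : f ≠ 0 := by
    rintro rfl
    obtain ⟨r, hr⟩ := hf 1
    exact hd 0 (hred _ ⟨r, by simpa using hr.symm⟩)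
  have hno : ∀ k, f ≠ ∑ i ∈ Finset.range k, c i • e i := by
    intro k
    induction k with
    | zero => simpa using hf0
    | succ k ih =>
      intro h
      rw [Finset.sum_range_succ] at h
      by_cases hck : c k = 0
      · rw [hck, zero_nsmul, add_zero] at h
        exact ih h
      · refine hg2 (ν k) (c k) hck ?_ ⟨_, h.trans (add_comm _ _)⟩
        have h1 : c k • ι (e k) = ι f - ∑ i ∈ Finset.range k, c i • ι (e i) := by
          have h2 := congrArg ι h
          rw [ι.map_add (∑ x ∈ Finset.range k, c x • e x) (c k • e k), map_sum] at h2
          simp only [map_nsmul] at h2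
          rw [eq_sub_iff_add_eq, add_comm]
          exact h2.symm
        change c k • ι (e k) ∈ _
        rw [h1]
        refine sub_mem (Submodule.subset_span (Or.inl rfl)) (sum_mem fun i hi => nsmul_mem ?_ _)
        have hik : ν (i + 1) ≤ ν k := hνm.monotone (Finset.mem_range.1 hi)
        rw [hν] at hik
        have := hg1 (ν i)
        change ι (d (ν i) + d (g (ν i))) ∈ _
        rw [map_add]
        exact add_mem (Submodule.subset_span (Or.inr ⟨_, by simp; omega, rfl⟩))
          (Submodule.subset_span (Or.inr ⟨_, by simp; omega, rfl⟩))
  apply hno (c.support.sup id + 1)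
  rw [hc, Finsupp.sum]
  refine Finset.sum_subset ?_ ?_
  · intro i hi
    rw [Finset.mem_range]
    exact Nat.lt_succ_of_le (Finset.le_sup (f := id) hi)
  · intro i _ hi
    simp [Finsupp.notMem_support_iff.1 hi]

theorem groth_torsionFree
    (htf : ∀ n : ℕ, n ≠ 0 → ∀ x y : M, n • x = n • y → x = y) :
    IsAddTorsionFree (Algebra.GrothendieckAddGroup M) := by
  have hinj := Algebra.GrothendieckAddGroup.of_injective (M := M)
  have hrep : ∀ z : Algebra.GrothendieckAddGroup M, ∃ x y : M,
      z + Algebra.GrothendieckAddGroup.of y = Algebra.GrothendieckAddGroup.of x := by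
    intro z
    obtain ⟨⟨x, y⟩, h⟩ := (AddLocalization.addMonoidOf (⊤ : AddSubmonoid M)).surj z
    exact ⟨x, y, h⟩
  have h0 : ∀ n : ℕ, n ≠ 0 → ∀ z : Algebra.GrothendieckAddGroup M, n • z = 0 → z = 0 := by
    intro n hn z hz
    obtain ⟨x, y, h⟩ := hrep z
    have h1 : n • y = n • x := by
      apply hinj
      rw [map_nsmul, map_nsmul, ← h, nsmul_add, hz, zero_add]
    rw [htf n hn y x h1] at h
    simpa using h
  refine ⟨fun n hn a b hab => ?_⟩
  have h1 := h0 n hn (a - b) (by rw [nsmul_sub, sub_eq_zero]; exact hab)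
  exact sub_eq_zero.1 h1

theorem accp_atomic (hred : ∀ x : M, IsMUnit x → x = 0) (h : SatisfiesACCP M)
    (N : AddSubmonoid M) : AtomicIn N := by
  have wf : WellFounded (fun y x : M => ∃ z, z ≠ 0 ∧ x = y + z) := by
    rw [wellFounded_iff_isEmpty_descending_chain]
    refine ⟨fun ⟨f, hf⟩ => ?_⟩
    choose z hz0 hz using hf
    obtain ⟨K, hK⟩ := h f fun n x ⟨c, hc⟩ => ⟨z n + c, by rw [hc, hz n, add_assoc]⟩
    have h1 : f (K + 1) ∈ PIdeal (f K) := by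
      rw [← hK (K + 1) (by omega)]
      exact ⟨0, by simp⟩
    obtain ⟨c, hc⟩ := h1
    rw [hz K, add_assoc] at hc
    exact hz0 K (hred _ ⟨c, by simpa using hc.symm⟩)
  intro x
  induction x using wf.induction with
  | _ x ih =>
    intro hx
    by_cases hu : IsUnitIn N x
    · exact Or.inl hu
    right
    by_cases ha : IsAtomIn N x
    · exact ⟨{x}, by simpa using ha, by simp⟩
    simp only [IsAtomIn, not_and, not_forall, not_or] at ha
    obtain ⟨b, hb, c, hc, rfl, hbu, hcu⟩ := ha hx hu
    have hne : ∀ y, ¬ IsUnitIn N y → y ≠ 0 := by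
      rintro y hy rfl
      exact hy ⟨0, zero_mem _, by simp⟩
    obtain ⟨l, hl, hl'⟩ := (ih b ⟨c, hne c hcu, rfl⟩ hb).resolve_left hbu
    obtain ⟨m, hm, hm'⟩ := (ih c ⟨b, hne b hbu, add_comm _ _⟩ hc).resolve_left hcu
    refine ⟨l + m, fun a ha => ?_, by simp [hl', hm']⟩
    rcases Multiset.mem_add.1 ha with h | h
    · exact hl a h
    · exact hm a h

theorem atomic_accp (hred : ∀ x : M, IsMUnit x → x = 0)
    (htf : ∀ n : ℕ, n ≠ 0 → ∀ x y : M, n • x = n • y → x = y)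
    (hat : ∀ N : AddSubmonoid M, AtomicIn N) : SatisfiesACCP M := by
  intro f hf
  by_contra! hcon
  have h1 : ∀ n, ∃ c, f n = f (n + 1) + c := fun n => hf n ⟨0, by simp⟩
  choose c hc using h1
  have hfr : ∀ K, ∃ n, K ≤ n ∧ c n ≠ 0 := by
    intro K
    by_contra! h
    have h2 : ∀ n, K ≤ n → f n = f K := by
      intro n hn
      induction n, hn using Nat.le_induction with
      | base => rfl
      | succ n hn ih => rw [← ih, hc n, h n hn, add_zero]
    obtain ⟨n, hn, hne⟩ := hcon K
    exact hne (by rw [h2 n hn])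
  have hsum : ∀ k, f 0 = ∑ i ∈ Finset.range k, c i + f k := by
    intro k
    induction k with
    | zero => simp
    | succ k ih => rw [ih, Finset.sum_range_succ, hc k, add_assoc, add_comm (c k)]
  obtain ⟨φ, hφ, hφc⟩ := Filter.extraction_of_frequently_atTop
    (Filter.frequently_atTop.2 fun K => hfr K)
  have := groth_torsionFree htf
  refine no_chain Algebra.GrothendieckAddGroup.of Algebra.GrothendieckAddGroup.of_injective
    hred hat (f 0) (fun i => c (φ i)) hφc fun k => ?_
  refine MLe.trans' ?_ ⟨_, hsum (φ k)⟩
  induction k with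
  | zero => exact ⟨_, by simp; rfl⟩
  | succ k ih =>
    rw [Finset.sum_range_succ]
    refine (ih.add_right' _).trans' ?_
    rw [← Finset.sum_range_succ]
    obtain ⟨q, hq⟩ := Nat.exists_eq_add_of_le (hφ (Nat.lt_succ_self k))
    rw [hq]
    exact ⟨_, Finset.sum_range_add _ _ _⟩

end Helpers

/-- A reduced, cancellative, commutative, torsion-free monoid satisfies the ACCP
if and only if every submonoid of it is atomic. -/
theorem accp_iff_hereditarily_atomic {M : Type*} [AddCancelCommMonoid M]
    (hred : ∀ x : M, IsMUnit x → x = 0)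
    (htf : ∀ n : ℕ, n ≠ 0 → ∀ x y : M, n • x = n • y → x = y) :
    SatisfiesACCP M ↔ ∀ N : AddSubmonoid M, AtomicIn N := by
  exact ⟨fun h N => accp_atomic hred h N, fun h => atomic_accp hred htf h⟩
end

section
/- Let M be a cancellative, commutative torsion-free monoid (not necessarily reduced). If every submonoid of M is atomic, then M satisfies the ACCP. -/
open Filter Topology

section HA
variable {M : Type*} [AddCancelCommMonoid M]

/-- `x` is invertible in the whole monoid. -/
def HAInv (x : M) : Prop := ∃ y, x + y = 0

theorem HAInv.left {x y : M} (h : HAInv (x + y)) : HAInv x := by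
  obtain ⟨z, hz⟩ := h
  exact ⟨y + z, by rw [← add_assoc, hz]⟩

theorem HAInv.right {x y : M} (h : HAInv (x + y)) : HAInv y := by
  rw [add_comm] at h; exact h.left

/-- A submonoid generated by elements not invertible in `M` is reduced. -/
theorem HA_reduced {S : Set M} (hS : ∀ s ∈ S, ¬ HAInv s) {x : M}
    (hx : x ∈ AddSubmonoid.closure S) (hi : HAInv x) : x = 0 := by
  induction hx using AddSubmonoid.closure_induction with
  | mem x h => exact absurd hi (hS x h)
  | zero => rfl
  | add x y _ _ h1 h2 => rw [h1 hi.left, h2 hi.right, add_zero]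

theorem HA_atom_mem {S : Set M} (hS : ∀ s ∈ S, ¬ HAInv s) {x : M}
    (hx : IsAtomIn (AddSubmonoid.closure S) x) : x ∈ S := by
  obtain ⟨hm, hu, hd⟩ := hx
  induction hm using AddSubmonoid.closure_induction with
  | mem x h => exact h
  | zero => exact absurd ⟨0, zero_mem _, add_zero _⟩ hu
  | add x y hx hy h1 h2 =>
    rcases hd x hx y hy rfl with h | h
    · have h0 : x = 0 := by
        obtain ⟨z, _, hz⟩ := h
        exact HA_reduced hS hx ⟨z, hz⟩
      subst h0
      rw [zero_add] at hu hd ⊢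
      exact h2 hu hd
    · have h0 : y = 0 := by
        obtain ⟨z, _, hz⟩ := h
        exact HA_reduced hS hy ⟨z, hz⟩
      subst h0
      rw [add_zero] at hu hd ⊢
      exact h1 hu hd

/-- Key lemma: along a strict chain, the first term is a sum of the differences. -/
theorem HA_key (hha : ∀ N : AddSubmonoid M, AtomicIn N) (b c : ℕ → M)
    (hb : ∀ n, b n = b (n + 1) + c n) (hc : ∀ n, ¬ HAInv (c n)) :
    b 0 ∈ AddSubmonoid.closure (Set.range c) := by
  have hbn : ∀ n, ¬ HAInv (b n) := fun n h => by
    rw [hb n] at h; exact hc n h.right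
  set S : Set M := Set.range b ∪ Set.range c with hSdef
  have hS : ∀ s ∈ S, ¬ HAInv s := by
    rintro s (⟨n, rfl⟩ | ⟨n, rfl⟩)
    · exact hbn n
    · exact hc n
  have hbS : ∀ n, b n ∈ AddSubmonoid.closure S := fun n =>
    AddSubmonoid.subset_closure (Or.inl ⟨n, rfl⟩)
  have hcS : ∀ n, c n ∈ AddSubmonoid.closure S := fun n =>
    AddSubmonoid.subset_closure (Or.inr ⟨n, rfl⟩)
  rcases hha (AddSubmonoid.closure S) (b 0) (hbS 0) with h | ⟨l, hl, hs⟩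
  · obtain ⟨z, _, hz⟩ := h
    exact absurd ⟨z, hz⟩ (hbn 0)
  · rw [← hs]
    refine AddSubmonoid.multiset_sum_mem _ _ fun a ha => ?_
    have hat := hl a ha
    rcases HA_atom_mem hS hat with ⟨n, rfl⟩ | h
    · exfalso
      rcases hat.2.2 _ (hbS (n + 1)) _ (hcS n) (hb n) with ⟨z, _, hz⟩ | ⟨z, _, hz⟩
      · exact hbn _ ⟨z, hz⟩
      · exact hc _ ⟨z, hz⟩
    · exact AddSubmonoid.subset_closure h

/-- Archimedean property. -/
theorem HA_arch (hha : ∀ N : AddSubmonoid M, AtomicIn N) (y d : M) (hd : ¬ HAInv d) :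
    ∃ K : ℕ, ∀ z, y ≠ z + K • d := by
  by_contra! h
  choose e he using h
  have h1 : ∀ n, e n = e (n + 1) + d := fun n => by
    have := (he n).symm.trans (he (n + 1))
    rw [succ_nsmul', ← add_assoc] at this
    exact add_right_cancel this
  have h2 := HA_key hha e (fun _ => d) h1 (fun _ => hd)
  rw [Set.range_const, AddSubmonoid.mem_closure_singleton] at h2
  obtain ⟨a, ha⟩ := h2
  have h3 := (he 0).symm.trans (he (a + 1))
  rw [← ha, zero_nsmul, add_zero, succ_nsmul', ← add_assoc] at h3
  refine hd ⟨e (a + 1), ?_⟩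
  have : (0 : M) + a • d = (e (a + 1) + d) + a • d := by rw [zero_add]; exact h3
  rw [add_comm]
  exact (add_right_cancel this).symm

/-- Existence of a homomorphism to the 2-adic numbers not killing `d`. -/
theorem HA_hom (d : M) (hd : ¬ HAInv d) : ∃ ψ : M →+ ℚ_[2], ψ d ≠ 0 := by
  let G := Algebra.GrothendieckAddGroup M
  let ι : M →+ G := Algebra.GrothendieckAddGroup.of
  have hι : Function.Injective ι := Algebra.GrothendieckAddGroup.of_injective
  let f : ℤ →+ G := zmultiplesHom G (ι d)
  have hnat : ∀ n : ℕ, n • ι d = 0 → n = 0 := fun n hn => by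
    rw [← map_nsmul, ← map_zero ι] at hn
    have h := hι hn
    cases n with
    | zero => rfl
    | succ k => exact absurd ⟨k • d, by rw [← succ_nsmul', h]⟩ hd
  have hf : Function.Injective f := by
    rw [injective_iff_map_eq_zero]
    intro a ha
    have hza : a • ι d = 0 := ha
    rcases Int.natAbs_eq a with h | h
    · rw [h, natCast_zsmul] at hza
      have := hnat _ hza
      omega
    · rw [h, neg_zsmul, natCast_zsmul, neg_eq_zero] at hza
      have := hnat _ hza
      omega
  let g : ℤ →+ ℚ_[2] := Int.castAddHom _
  have : DivisibleBy ℚ_[2] ℤ := AddCommGroup.divisibleByIntOfSMulTopEqTop _ (by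
    intro n hn
    rw [eq_top_iff]
    rintro x -
    refine ⟨x / n, trivial, ?_⟩
    have : (n : ℚ_[2]) ≠ 0 := by exact_mod_cast hn
    simp
    field_simp)
  obtain ⟨h, hh⟩ := (Module.Baer.of_divisible ℚ_[2]).extension_property_addMonoidHom f hf g
  refine ⟨h.comp ι, ?_⟩
  have := DFunLike.congr_fun hh 1
  simp [f, g] at this
  simp [this]

theorem HA_chain_le {b c : ℕ → M} (hb : ∀ n, b n = b (n + 1) + c n) (n m : ℕ) (h : n ≤ m) :
    ∃ r, b n = b m + r := by
  induction m, h using Nat.le_induction with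
  | base => exact ⟨0, (add_zero _).symm⟩
  | succ m _ ih =>
    obtain ⟨r, hr⟩ := ih
    exact ⟨c m + r, by rw [hr, hb m, add_assoc]⟩

theorem HA_sub {b c : ℕ → M} (hb : ∀ n, b n = b (n + 1) + c n) (φ : ℕ → ℕ)
    (hφ : ∀ n, φ n < φ (n + 1)) :
    ∃ r : ℕ → M, ∀ n, b (φ n) = b (φ (n + 1)) + (c (φ n) + r n) := by
  have : ∀ n, ∃ r, b (φ n) = b (φ (n + 1)) + (c (φ n) + r) := fun n => by
    obtain ⟨r, hr⟩ := HA_chain_le hb (φ n + 1) (φ (n + 1)) (hφ n)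
    exact ⟨r, by rw [hb (φ n), hr, add_assoc, add_comm r]⟩
  exact ⟨_, fun n => (this n).choose_spec⟩

/-- Bounded case with nonzero limit. -/
theorem HA_caseA (hha : ∀ N : AddSubmonoid M, AtomicIn N) (b c : ℕ → M)
    (hb : ∀ n, b n = b (n + 1) + c n) (hc : ∀ n, ¬ HAInv (c n)) (ψ : M →+ ℚ_[2])
    (φ : ℕ → ℕ) (hφ : StrictMono φ) (ℓ : ℚ_[2]) (hℓ : ℓ ≠ 0)
    (hlim : Tendsto (fun n => ψ (b (φ n))) atTop (𝓝 ℓ)) : False := by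
  obtain ⟨N, hN⟩ := Metric.tendsto_atTop.1 hlim ‖ℓ‖ (norm_pos_iff.2 hℓ)
  obtain ⟨r, hr⟩ := HA_sub hb (fun n => φ (N + n)) (fun n => hφ (by omega))
  have key := HA_key hha (fun n => b (φ (N + n))) _ hr (fun n h => hc _ h.left)
  have hsmall : ∀ n, ‖ψ (b (φ (N + n))) - ℓ‖ < ‖ℓ‖ := fun n => by
    rw [← dist_eq_norm]; exact hN _ (by omega)
  have hall : ∀ x ∈ AddSubmonoid.closure (Set.range fun n => c (φ (N + n)) + r n),
      ‖ψ x‖ < ‖ℓ‖ := by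
    intro x hx
    induction hx using AddSubmonoid.closure_induction with
    | mem x h =>
      obtain ⟨n, rfl⟩ := h
      have e : ψ (c (φ (N + n)) + r n)
          = (ψ (b (φ (N + n))) - ℓ) + -(ψ (b (φ (N + (n + 1)))) - ℓ) := by
        have := congrArg ψ (hr n)
        rw [map_add] at this
        rw [this]; ring
      change ‖ψ (c (φ (N + n)) + r n)‖ < _
      rw [e]
      refine (Padic.nonarchimedean _ _).trans_lt (max_lt (hsmall n) ?_)
      rw [norm_neg]
      exact hsmall (n + 1)
    | zero => rw [map_zero, norm_zero]; exact norm_pos_iff.2 hℓ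
    | add x y _ _ h1 h2 =>
      rw [map_add]
      exact (Padic.nonarchimedean _ _).trans_lt (max_lt h1 h2)
  have h0 := hall _ key
  have : ‖ℓ‖ < ‖ℓ‖ := by
    have e : ℓ = ψ (b (φ (N + 0))) + -(ψ (b (φ (N + 0))) - ℓ) := by ring
    calc ‖ℓ‖ = ‖ψ (b (φ (N + 0))) + -(ψ (b (φ (N + 0))) - ℓ)‖ := by rw [← e]
      _ ≤ _ := Padic.nonarchimedean _ _
      _ < ‖ℓ‖ := max_lt h0 (by rw [norm_neg]; exact hsmall 0)
  exact lt_irrefl _ this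

/-- Unbounded case. -/
theorem HA_caseB (hha : ∀ N : AddSubmonoid M, AtomicIn N) (b c : ℕ → M)
    (hb : ∀ n, b n = b (n + 1) + c n) (hc : ∀ n, ¬ HAInv (c n)) (ψ : M →+ ℚ_[2])
    (hlim : ∀ B : ℝ, ∀ᶠ n in atTop, B < ‖ψ (b n)‖) : False := by
  obtain ⟨n0, hn0⟩ := (hlim 0).exists
  choose K hK using fun n => HA_arch hha (b n0) (c n) (hc n)
  have hnext : ∀ n, ∃ m, n < m ∧ 2 ^ (K n + 1) * ‖ψ (b n)‖ < ‖ψ (b m)‖ := fun n =>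
    ((eventually_gt_atTop n).and (hlim _)).exists
  choose nx hnx1 hnx2 using hnext
  let φ : ℕ → ℕ := fun k => nx^[k] n0
  have hφs : ∀ k, φ (k + 1) = nx (φ k) := fun k => Function.iterate_succ_apply' _ _ _
  obtain ⟨r, hr⟩ := HA_sub hb φ (fun n => by rw [hφs]; exact hnx1 _)
  have key := HA_key hha (fun n => b (φ n)) _ hr (fun n h => hc _ h.left)
  set cc : ℕ → M := fun n => c (φ n) + r n with hcc
  have hg : ∀ k, 2 ^ (K (φ k) + 1) * ‖ψ (b (φ k))‖ < ‖ψ (b (φ (k + 1)))‖ := fun k => by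
    rw [hφs]; exact hnx2 _
  have hg1 : ∀ k, ‖ψ (b (φ k))‖ < ‖ψ (b (φ (k + 1)))‖ := fun k => by
    refine lt_of_le_of_lt ?_ (hg k)
    exact le_mul_of_one_le_left (norm_nonneg _) (one_le_pow₀ (by norm_num))
  have hmono : StrictMono fun k => ‖ψ (b (φ k))‖ := strictMono_nat_of_lt_succ hg1
  have hcn : ∀ k, ‖ψ (cc k)‖ = ‖ψ (b (φ (k + 1)))‖ := fun k => by
    have e : ψ (cc k) = ψ (b (φ k)) + -ψ (b (φ (k + 1))) := by
      have := congrArg ψ (hr k)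
      rw [map_add] at this
      rw [this]; simp only [cc]; ring
    rw [e, Padic.add_eq_max_of_ne (by rw [norm_neg]; exact (hg1 k).ne), norm_neg]
    exact max_eq_right (hg1 k).le
  have hbound : ∀ m, ∀ x ∈ AddSubmonoid.closure (Set.image cc (Set.Iio m)),
      ‖ψ x‖ ≤ ‖ψ (b (φ m))‖ := by
    intro m x hx
    induction hx using AddSubmonoid.closure_induction with
    | mem x h =>
      obtain ⟨k, hk, rfl⟩ := h
      rw [hcn]
      exact hmono.monotone hk
    | zero => rw [map_zero, norm_zero]; exact norm_nonneg _
    | add x y _ _ h1 h2 =>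
      rw [map_add]
      exact (Padic.nonarchimedean _ _).trans (max_le h1 h2)
  have hno : ∀ m, b (φ 0) ∉ AddSubmonoid.closure (Set.image cc (Set.Iio m)) := by
    intro m
    induction m with
    | zero =>
      intro h
      have hz : b (φ 0) = 0 := by simpa using h
      have : (0 : ℝ) < ‖ψ (b (φ 0))‖ := hn0
      rw [hz, map_zero, norm_zero] at this
      exact lt_irrefl _ this
    | succ m ih =>
      intro h
      have hI : Set.image cc (Set.Iio (m + 1)) = Set.image cc (Set.Iio m) ∪ {cc m} := by
        rw [← Set.image_singleton, ← Set.image_union]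
        congr 1
        ext i
        simp only [Set.mem_Iio, Set.mem_union, Set.mem_singleton_iff]
        omega
      rw [hI, AddSubmonoid.closure_union, AddSubmonoid.mem_sup] at h
      obtain ⟨s, hs, t, ht, hst⟩ := h
      rw [AddSubmonoid.mem_closure_singleton] at ht
      obtain ⟨a, rfl⟩ := ht
      rcases Nat.eq_zero_or_pos a with rfl | ha
      · rw [zero_nsmul, add_zero] at hst
        exact ih (hst ▸ hs)
      have h1 : ‖(a : ℚ_[2])‖ * ‖ψ (cc m)‖ ≤ ‖ψ (b (φ m))‖ := by
        have e : (a : ℚ_[2]) * ψ (cc m) = ψ (b (φ 0)) + - ψ s := by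
          rw [← hst, map_add ψ s, map_nsmul, nsmul_eq_mul]; ring
        rw [← norm_mul, e]
        refine (Padic.nonarchimedean _ _).trans (max_le ?_ ?_)
        · exact hmono.monotone (Nat.zero_le m)
        · rw [norm_neg]; exact hbound m s hs
      rw [hcn] at h1
      have hpos : 0 < ‖ψ (b (φ m))‖ :=
        lt_of_lt_of_le (show 0 < ‖ψ (b (φ 0))‖ from hn0) (hmono.monotone (Nat.zero_le m))
      have h2 : ‖((a : ℤ) : ℚ_[2])‖ ≤ ((2 : ℕ) : ℝ) ^ (-(K (φ m) : ℤ)) := by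
        have hp : (0 : ℝ) < 2 ^ (K (φ m)) := by positivity
        rw [zpow_neg, zpow_natCast, Int.cast_natCast]
        push_cast
        rw [← one_div, le_div_iff₀ hp]
        by_contra! hlt
        have h3 := hg m
        have h4 : (2 : ℝ) ^ (K (φ m)) * ‖ψ (b (φ m))‖ ≤ ‖ψ (b (φ (m + 1)))‖ := by
          rw [pow_succ] at h3
          nlinarith [mul_pos hp hpos]
        have h5 := mul_le_mul_of_nonneg_left h4 (norm_nonneg (a : ℚ_[2]))
        nlinarith
      rw [Padic.norm_int_le_pow_iff_dvd] at h2
      have h3 : 2 ^ K (φ m) ∣ a := by exact_mod_cast h2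
      have h4 : K (φ m) ≤ a := (Nat.lt_two_pow_self).le.trans (Nat.le_of_dvd ha h3)
      obtain ⟨j, rfl⟩ := Nat.exists_eq_add_of_le h4
      refine hK (φ m) (s + K (φ m) • r m + j • cc m) ?_
      have : b n0 = b (φ 0) := rfl
      rw [this, ← hst, add_nsmul]
      simp only [cc, nsmul_add]
      abel
  have hex : ∀ x ∈ AddSubmonoid.closure (Set.range cc),
      ∃ m, x ∈ AddSubmonoid.closure (Set.image cc (Set.Iio m)) := by
    intro x hx
    induction hx using AddSubmonoid.closure_induction with
    | mem x h =>
      obtain ⟨k, rfl⟩ := h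
      exact ⟨k + 1, AddSubmonoid.subset_closure ⟨k, Nat.lt_succ_self k, rfl⟩⟩
    | zero => exact ⟨0, zero_mem _⟩
    | add x y _ _ h1 h2 =>
      obtain ⟨m, hm⟩ := h1
      obtain ⟨n, hn⟩ := h2
      refine ⟨max m n, add_mem ?_ ?_⟩
      · exact AddSubmonoid.closure_mono
          (Set.image_mono (Set.Iio_subset_Iio (le_max_left _ _))) hm
      · exact AddSubmonoid.closure_mono
          (Set.image_mono (Set.Iio_subset_Iio (le_max_right _ _))) hn
  obtain ⟨m, hm⟩ := hex _ key
  exact hno m hm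

theorem HA_nochain (hha : ∀ N : AddSubmonoid M, AtomicIn N) (b c : ℕ → M)
    (hb : ∀ n, b n = b (n + 1) + c n) (hc : ∀ n, ¬ HAInv (c n)) : False := by
  obtain ⟨ψ, hψ⟩ := HA_hom (c 0) (hc 0)
  by_cases h : ∀ B : ℝ, ∀ᶠ n in atTop, B < ‖ψ (b n)‖
  · exact HA_caseB hha b c hb hc ψ h
  · push Not at h
    obtain ⟨B, hB⟩ := h
    obtain ⟨ℓ, -, φ, hφ, hl⟩ := tendsto_subseq_of_frequently_bounded
      (s := Metric.closedBall (0 : ℚ_[2]) B) Metric.isBounded_closedBall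
      (x := fun n => ψ (b n)) (hB.mono fun n hn => by simpa using hn)
    by_cases hℓ : ℓ = 0
    · refine HA_caseA hha (fun n => b n + c 0) c (fun n => ?_) hc ψ φ hφ (ℓ + ψ (c 0))
        (by rw [hℓ, zero_add]; exact hψ) ?_
      · rw [hb n]; abel
      · simp only [map_add]
        exact hl.add_const _
    · exact HA_caseA hha b c hb hc ψ φ hφ ℓ hℓ hl

end HA

/-- If every submonoid of a cancellative commutative torsion-free monoid `M`
(not necessarily reduced) is atomic, then `M` satisfies the ACCP. -/
theorem hereditarily_atomic_implies_accp {M : Type*} [AddCancelCommMonoid M]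
    (htf : ∀ n : ℕ, n ≠ 0 → ∀ x y : M, n • x = n • y → x = y)
    (hha : ∀ N : AddSubmonoid M, AtomicIn N) :
    SatisfiesACCP M := by
  intro f hf
  have h1 : ∀ n, ∃ c, f n = f (n + 1) + c := fun n => hf n ⟨0, (add_zero _).symm⟩
  choose c hc using h1
  by_contra! hcon
  have hmono : Monotone fun n => PIdeal (f n) := monotone_nat_of_le_succ hf
  have hfreq : ∀ N, ∃ n > N, ¬ HAInv (c n) := by
    intro N
    by_contra! hall
    obtain ⟨n, hn, hne⟩ := hcon (N + 1)
    apply hne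
    induction n, hn using Nat.le_induction with
    | base => rfl
    | succ n hn ih =>
      have h2 : PIdeal (f (n + 1)) = PIdeal (f n) := by
        refine Set.Subset.antisymm ?_ (hf n)
        rintro x ⟨y, rfl⟩
        obtain ⟨z, hz⟩ := hall n (by omega)
        refine ⟨z + y, ?_⟩
        rw [hc n, add_assoc, ← add_assoc (c n), hz, zero_add]
      rw [h2]
      by_contra h3
      exact h3 (ih h3)
  obtain ⟨φ, hφ, hP⟩ := Nat.exists_strictMono_subsequence hfreq
  obtain ⟨r, hr⟩ := HA_sub hc φ (fun n => hφ (Nat.lt_succ_self n))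
  exact HA_nochain hha (fun n => f (φ n)) _ hr (fun n h => hP n h.left)
end
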